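/- Let λ > 0, a > 0, and let Q : ℝ → ℝ be integrable with support in [0, a] with associated finiteness condition on M as above, and let K_Q be the unique fixed point of the Gelfand–Levitan map. Then the map Q ↦ K_Q is continuous from L¹ into the supremum norm: there exist η > 0 and C > 0 (depending on a, λ and Q) such that for every integrable Q̃ supported in [0, a] with ‖Q̃ − Q‖_{L¹} ≤ η, the fixed point K_{Q̃} exists and satisfies ‖K_{Q̃} − K_Q‖_∞ ≤ C · ‖Q̃ − Q‖_{L¹}. -/

import Mathlib

open MeasureTheory

/-- The integral part of the Gelfand–Levitan fixed-point map. -/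
noncomputable def GLop (q q₀ : ℝ → ℝ) (L : ℝ × ℝ → ℝ) : ℝ × ℝ → ℝ := fun w =>
  ∫ α in Set.Ioi ((w.2 + w.1) / 2), ∫ β in (0:ℝ)..((w.2 - w.1) / 2),
    (q (α - β) - q₀ (α + β)) * L (α - β, α + β)

/-- The closed triangle `0 ≤ β ≤ α ≤ a` in characteristic coordinates `(α, β)`. -/
def charTriangle (a : ℝ) : Set (ℝ × ℝ) := {w | 0 ≤ w.2 ∧ w.2 ≤ w.1 ∧ w.1 ≤ a}

lemma isClosed_charTriangle (a : ℝ) : IsClosed (charTriangle a) :=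
  (isClosed_le continuous_const continuous_snd).inter
    ((isClosed_le continuous_snd continuous_fst).inter (isClosed_le continuous_fst continuous_const))

lemma isCompact_charTriangle (a : ℝ) : IsCompact (charTriangle a) := by
  refine (isCompact_Icc.prod isCompact_Icc : IsCompact (Set.Icc 0 a ×ˢ Set.Icc 0 a)).of_isClosed_subset
    (isClosed_charTriangle a) ?_
  rintro ⟨α, β⟩ ⟨h0, h1, h2⟩
  simp only at h0 h1 h2
  exact ⟨⟨by linarith, by linarith⟩, ⟨by linarith, by linarith⟩⟩

lemma measurableSet_charTriangle (a : ℝ) : MeasurableSet (charTriangle a) :=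
  (isClosed_charTriangle a).measurableSet

/-- The integral of an integrable function over the quadrant-like strip `(ξ, ∞) × (0, η]` is
continuous in `(ξ, η)`. -/
lemma continuous_setIntegral_Ioi_prod_Ioc {G : ℝ × ℝ → ℝ} (hG : Integrable G) :
    Continuous fun z : ℝ × ℝ => ∫ w in Set.Ioi z.1 ×ˢ Set.Ioc 0 z.2, G w := by
  have hmeas : ∀ z : ℝ × ℝ, MeasurableSet (Set.Ioi z.1 ×ˢ Set.Ioc 0 z.2) :=
    fun z => measurableSet_Ioi.prod measurableSet_Ioc
  simp_rw [← fun z : ℝ × ℝ => integral_indicator (f := G) (μ := volume) (hmeas z)]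
  rw [continuous_iff_continuousAt]
  intro z
  refine continuousAt_of_dominated (bound := fun w => ‖G w‖)
    (.of_forall fun y => hG.aestronglyMeasurable.indicator (hmeas y))
    (.of_forall fun y => .of_forall fun w => norm_indicator_le_norm_self _ _) hG.norm ?_
  have h1 : ∀ᵐ w : ℝ × ℝ, w.1 ≠ z.1 :=
    Measure.quasiMeasurePreserving_fst.ae (Measure.ae_ne volume z.1)
  have h2 : ∀ᵐ w : ℝ × ℝ, w.2 ≠ z.2 :=
    Measure.quasiMeasurePreserving_snd.ae (Measure.ae_ne volume z.2)
  filter_upwards [h1, h2] with w hw1 hw2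
  have e1 : ∀ᶠ y : ℝ × ℝ in nhds z, (y.1 < w.1 ↔ z.1 < w.1) := by
    rcases lt_or_gt_of_ne hw1 with h | h
    · filter_upwards [continuousAt_fst.eventually (lt_mem_nhds h)] with y hy
      exact ⟨fun h' => absurd h' hy.not_gt, fun h' => absurd h' h.not_gt⟩
    · filter_upwards [continuousAt_fst.eventually (gt_mem_nhds h)] with y hy
      exact ⟨fun _ => h, fun _ => hy⟩
  have e2 : ∀ᶠ y : ℝ × ℝ in nhds z, (w.2 ≤ y.2 ↔ w.2 ≤ z.2) := by
    rcases lt_or_gt_of_ne hw2 with h | h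
    · filter_upwards [continuousAt_snd.eventually (lt_mem_nhds h)] with y hy
      exact ⟨fun _ => h.le, fun _ => le_of_lt hy⟩
    · filter_upwards [continuousAt_snd.eventually (gt_mem_nhds h)] with y hy
      exact ⟨fun h' => absurd h' (not_le_of_gt hy), fun h' => absurd h' h.not_ge⟩
  refine ContinuousAt.congr (continuousAt_const (y := (Set.Ioi z.1 ×ˢ Set.Ioc 0 z.2).indicator G w)) ?_
  filter_upwards [e1, e2] with y hy1 hy2
  simp only [Set.indicator, Set.mem_prod, Set.mem_Ioi, Set.mem_Ioc, hy1, hy2]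

/-- The Volterra-type operator with kernel `k` on the triangle, in characteristic coordinates. -/
noncomputable def charVolterra (a : ℝ) (k m : ℝ × ℝ → ℝ) (z : ℝ × ℝ) : ℝ :=
  ∫ w in Set.Ioi z.1 ×ˢ Set.Ioc 0 z.2, (charTriangle a).indicator (fun w => k w * m w) w

section charVolterra

variable {a : ℝ} {k k' m m' : ℝ × ℝ → ℝ}

lemma integrable_indicator_charTriangle_mul (hk : IntegrableOn k (charTriangle a))
    (hm : ContinuousOn m (charTriangle a)) :
    Integrable ((charTriangle a).indicator fun w => k w * m w) :=
  (integrable_indicator_iff (measurableSet_charTriangle a)).2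
    (hk.mul_continuousOn hm (isCompact_charTriangle a))

lemma continuous_charVolterra (hk : IntegrableOn k (charTriangle a))
    (hm : ContinuousOn m (charTriangle a)) : Continuous (charVolterra a k m) :=
  continuous_setIntegral_Ioi_prod_Ioc (integrable_indicator_charTriangle_mul hk hm)

lemma charVolterra_eq_zero {z : ℝ × ℝ} (hz : a ≤ z.1) : charVolterra a k m z = 0 := by
  refine setIntegral_eq_zero_of_forall_eq_zero fun w hw => ?_
  refine Set.indicator_of_notMem (fun h => ?_) _
  exact absurd (hz.trans_lt hw.1) h.2.2.not_gt

lemma charVolterra_add_right (hk : IntegrableOn k (charTriangle a))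
    (hm : ContinuousOn m (charTriangle a)) (hm' : ContinuousOn m' (charTriangle a)) (z : ℝ × ℝ) :
    charVolterra a k (fun w => m w + m' w) z = charVolterra a k m z + charVolterra a k m' z := by
  simp only [charVolterra]
  rw [← integral_add (integrable_indicator_charTriangle_mul hk hm).integrableOn
    (integrable_indicator_charTriangle_mul hk hm').integrableOn]
  congr 1 with w
  simp only [Set.indicator]
  split_ifs <;> ring

lemma charVolterra_add_left (hk : IntegrableOn k (charTriangle a))
    (hk' : IntegrableOn k' (charTriangle a)) (hm : ContinuousOn m (charTriangle a)) (z : ℝ × ℝ) :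
    charVolterra a (fun w => k w + k' w) m z = charVolterra a k m z + charVolterra a k' m z := by
  simp only [charVolterra]
  rw [← integral_add (integrable_indicator_charTriangle_mul hk hm).integrableOn
    (integrable_indicator_charTriangle_mul hk' hm).integrableOn]
  congr 1 with w
  simp only [Set.indicator]
  split_ifs <;> ring

lemma abs_charVolterra_le_mul_setIntegral (hk : IntegrableOn k (charTriangle a))
    (hm : ContinuousOn m (charTriangle a)) {B : ℝ} (hB : ∀ w ∈ charTriangle a, |m w| ≤ B)
    (z : ℝ × ℝ) : |charVolterra a k m z| ≤ B * ∫ w in charTriangle a, |k w| := by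
  have hG := integrable_indicator_charTriangle_mul hk hm
  calc |charVolterra a k m z|
      ≤ ∫ w in Set.Ioi z.1 ×ˢ Set.Ioc 0 z.2, ‖(charTriangle a).indicator (fun w => k w * m w) w‖ := by
        rw [charVolterra, ← Real.norm_eq_abs]
        exact norm_integral_le_integral_norm _
    _ ≤ ∫ w, ‖(charTriangle a).indicator (fun w => k w * m w) w‖ :=
        setIntegral_le_integral hG.norm (.of_forall fun w => norm_nonneg _)
    _ = ∫ w in charTriangle a, |k w * m w| := by
        simp_rw [norm_indicator_eq_indicator_norm]
        exact integral_indicator (measurableSet_charTriangle a)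
    _ ≤ ∫ w in charTriangle a, B * |k w| := by
        refine setIntegral_mono_on (hk.mul_continuousOn hm (isCompact_charTriangle a)).norm
          (hk.norm.const_mul B) (measurableSet_charTriangle a) fun w hw => ?_
        rw [abs_mul, mul_comm]
        exact mul_le_mul_of_nonneg_right (hB w hw) (abs_nonneg _)
    _ = B * ∫ w in charTriangle a, |k w| := integral_const_mul _ _

lemma abs_charVolterra_le_mul_integral_Ioi (hk : IntegrableOn k (charTriangle a)) {P : ℝ}
    (hP : ∀ α, ∫ β, |(charTriangle a).indicator k (α, β)| ≤ P)
    (hm : ContinuousOn m (charTriangle a)) {c : ℝ → ℝ} (hc : Continuous c) (hc0 : ∀ α, 0 ≤ c α)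
    (hmc : ∀ w ∈ charTriangle a, |m w| ≤ c w.1) {z : ℝ × ℝ} (hci : IntegrableOn c (Set.Ioi z.1)) :
    |charVolterra a k m z| ≤ P * ∫ α in Set.Ioi z.1, c α := by
  have hG := integrable_indicator_charTriangle_mul hk hm
  have hH := (integrable_indicator_charTriangle_mul (m := fun w => c w.1) hk
    (hc.comp continuous_fst).continuousOn).norm
  have hslice : ∀ α, ∫ β, ‖(charTriangle a).indicator (fun w => k w * c w.1) (α, β)‖ =
      c α * ∫ β, |(charTriangle a).indicator k (α, β)| := by
    intro α
    rw [← integral_const_mul]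
    congr 1 with β
    simp only [Set.indicator, Real.norm_eq_abs]
    split_ifs
    · rw [abs_mul, abs_of_nonneg (hc0 α), mul_comm]
    · simp
  have hHi : IntegrableOn (fun w => ‖(charTriangle a).indicator (fun w => k w * c w.1) w‖)
      (Set.Ioi z.1 ×ˢ Set.univ) (volume.prod volume) := hH.integrableOn
  calc |charVolterra a k m z|
      ≤ ∫ w in Set.Ioi z.1 ×ˢ Set.Ioc 0 z.2, ‖(charTriangle a).indicator (fun w => k w * m w) w‖ := by
        rw [charVolterra, ← Real.norm_eq_abs]
        exact norm_integral_le_integral_norm _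
    _ ≤ ∫ w in Set.Ioi z.1 ×ˢ Set.Ioc 0 z.2,
          ‖(charTriangle a).indicator (fun w => k w * c w.1) w‖ := by
        refine setIntegral_mono hG.norm.integrableOn hH.integrableOn fun w => ?_
        simp only [Set.indicator, Real.norm_eq_abs]
        split_ifs with h
        · rw [abs_mul, abs_mul, abs_of_nonneg (hc0 w.1)]
          exact mul_le_mul_of_nonneg_left (hmc w h) (abs_nonneg _)
        · simp
    _ ≤ ∫ w in Set.Ioi z.1 ×ˢ Set.univ,
          ‖(charTriangle a).indicator (fun w => k w * c w.1) w‖ :=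
        setIntegral_mono_set hH.integrableOn (.of_forall fun w => norm_nonneg _)
          (Set.prod_mono_right (Set.subset_univ _)).eventuallyLE
    _ = ∫ α in Set.Ioi z.1, ∫ β, ‖(charTriangle a).indicator (fun w => k w * c w.1) (α, β)‖ := by
        rw [Measure.volume_eq_prod, setIntegral_prod _ hHi]
        simp
    _ ≤ ∫ α in Set.Ioi z.1, P * c α := by
        refine setIntegral_mono (Integrable.integral_prod_left hH).integrableOn
          (hci.const_mul P) fun α => ?_
        dsimp only
        rw [hslice, mul_comm P]
        exact mul_le_mul_of_nonneg_left (hP α) (hc0 α)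
    _ = P * ∫ α in Set.Ioi z.1, c α := integral_const_mul _ _

/-- Solvability of the Volterra equation `u = F + V u` on the triangle, with a bound depending only
on the size of the kernel and of `F`. -/
lemma exists_eq_add_charVolterra {P : ℝ} (hP0 : 0 < P) (hk : IntegrableOn k (charTriangle a))
    (hP : ∀ α, ∫ β, |(charTriangle a).indicator k (α, β)| ≤ P)
    {F : ℝ × ℝ → ℝ} (hF : Continuous F) (hF0 : ∀ z, a ≤ z.1 → F z = 0) {B : ℝ}
    (hB : ∀ z, |F z| ≤ B) :
    ∃ u : ℝ × ℝ → ℝ, Continuous u ∧ (∀ z, a ≤ z.1 → u z = 0) ∧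
      (∀ z, u z = F z + charVolterra a k u z) ∧
      ∀ z, 0 ≤ z.1 → |u z| ≤ 2 * (Real.exp (2 * P * a) * B) := by
  have hB0 : 0 ≤ B := (abs_nonneg _).trans (hB 0)
  set e : ℝ → ℝ := fun s => Real.exp (-(2 * P) * s) with he
  set e' : ℝ → ℝ := fun s => Real.exp (2 * P * s) with he'
  have hec : Continuous e := by fun_prop
  have hec' : Continuous e' := by fun_prop
  have hee : ∀ s, e' s * e s = 1 := fun s => by
    simp only [he, he']; rw [← Real.exp_add]; simp
  have he0 : ∀ s, 0 < e s := fun s => Real.exp_pos _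
  have he0' : ∀ s, 0 < e' s := fun s => Real.exp_pos _
  have hneg : -(2 * P) < 0 := by linarith
  have hmc : ∀ v : ℝ × ℝ → ℝ, Continuous v →
      ContinuousOn (fun w => e w.1 * v w) (charTriangle a) := fun v hv =>
    ((hec.comp continuous_fst).mul hv).continuousOn
  have hV : ∀ v : ℝ × ℝ → ℝ, Continuous v → ∀ N : ℝ, 0 ≤ N → (∀ w, |v w| ≤ N) → ∀ z : ℝ × ℝ,
      |e' z.1 * charVolterra a k (fun w => e w.1 * v w) z| ≤ 1 / 2 * N := by
    intro v hv N hN hvN z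
    have hi : IntegrableOn e (Set.Ioi z.1) := integrableOn_exp_mul_Ioi hneg _
    have h := abs_charVolterra_le_mul_integral_Ioi (m := fun w => e w.1 * v w)
      (c := fun α => e α * N) (z := z) hk hP (hmc v hv)
      (hec.mul continuous_const) (fun α => mul_nonneg (he0 α).le hN)
      (fun w _ => by
        rw [abs_mul, abs_of_pos (he0 _)]
        exact mul_le_mul_of_nonneg_left (hvN w) (he0 _).le) (hi.mul_const N)
    rw [integral_mul_const, integral_exp_mul_Ioi hneg] at h
    rw [abs_mul, abs_of_pos (he0' _)]
    calc _ ≤ e' z.1 * (P * (-e z.1 / -(2 * P) * N)) :=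
          mul_le_mul_of_nonneg_left h (he0' _).le
      _ = (e' z.1 * e z.1) * (1 / 2 * N) := by field_simp
      _ = 1 / 2 * N := by rw [hee, one_mul]
  have hFe : ∀ z : ℝ × ℝ, ‖e' z.1 * F z‖ ≤ Real.exp (2 * P * a) * B := by
    intro z
    rcases le_total a z.1 with h | h
    · rw [hF0 z h, mul_zero, norm_zero]; positivity
    · rw [Real.norm_eq_abs, abs_mul, abs_of_pos (he0' _)]
      have : e' z.1 ≤ Real.exp (2 * P * a) :=
        Real.exp_le_exp.2 (mul_le_mul_of_nonneg_left h (by linarith))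
      exact mul_le_mul this (hB z) (abs_nonneg _) (Real.exp_pos _).le
  let X := BoundedContinuousFunction (ℝ × ℝ) ℝ
  let f : X := BoundedContinuousFunction.ofNormedAddCommGroup (fun z => e' z.1 * F z)
    ((hec'.comp continuous_fst).mul hF) _ hFe
  let T : X → X := fun v => BoundedContinuousFunction.ofNormedAddCommGroup
    (fun z => e' z.1 * charVolterra a k (fun w => e w.1 * v w) z)
    ((hec'.comp continuous_fst).mul (continuous_charVolterra hk (hmc v v.continuous)))
    (1 / 2 * ‖v‖) (hV v v.continuous ‖v‖ (norm_nonneg _) v.norm_coe_le_norm)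
  have hTn : ∀ v, ‖T v‖ ≤ 1 / 2 * ‖v‖ := fun v =>
    BoundedContinuousFunction.norm_ofNormedAddCommGroup_le _ (by positivity) _
  have hTs : ∀ v v', T v' = T v + T (v' - v) := by
    intro v v'
    ext z
    change e' z.1 * charVolterra a k (fun w => e w.1 * v' w) z =
      e' z.1 * charVolterra a k (fun w => e w.1 * v w) z +
      e' z.1 * charVolterra a k (fun w => e w.1 * (v' - v) w) z
    rw [← mul_add, ← charVolterra_add_right hk (hmc v v.continuous)
      (hmc _ (v' - v).continuous)]
    have hw : (fun w => e w.1 * v' w) = fun w => e w.1 * v w + e w.1 * (v' - v) w := by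
      funext w
      rw [BoundedContinuousFunction.sub_apply]
      ring
    rw [hw]
  have hcontr : ContractingWith (1 / 2) (fun v => f + T v) := by
    refine ⟨by norm_num [← NNReal.coe_lt_coe], LipschitzWith.of_dist_le_mul fun v' v => ?_⟩
    rw [dist_add_left, dist_eq_norm, hTs v v', add_sub_cancel_left, dist_eq_norm]
    simpa using hTn (v' - v)
  obtain ⟨v, hv⟩ : ∃ v : X, f + T v = v := ⟨_, hcontr.fixedPoint_isFixedPt⟩
  have hvn : ‖v‖ ≤ 2 * (Real.exp (2 * P * a) * B) := by
    have h1 : ‖f‖ ≤ Real.exp (2 * P * a) * B :=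
      BoundedContinuousFunction.norm_ofNormedAddCommGroup_le _ (by positivity) _
    have h2 : ‖v‖ ≤ ‖f‖ + ‖T v‖ := by
      calc ‖v‖ = ‖f + T v‖ := by rw [hv]
        _ ≤ _ := norm_add_le _ _
    linarith [hTn v]
  have hu : ∀ z : ℝ × ℝ, e z.1 * v z = F z + charVolterra a k (fun w => e w.1 * v w) z := by
    intro z
    have h : v z = e' z.1 * F z + e' z.1 * charVolterra a k (fun w => e w.1 * v w) z :=
      (DFunLike.congr_fun hv z).symm
    calc e z.1 * v z
        = (e' z.1 * e z.1) * (F z + charVolterra a k (fun w => e w.1 * v w) z) := by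
          rw [h]; ring
      _ = _ := by rw [hee, one_mul]
  refine ⟨fun z => e z.1 * v z, (hec.comp continuous_fst).mul v.continuous, fun z hz => ?_, hu,
    fun z hz => ?_⟩
  · dsimp only
    rw [hu, hF0 z hz, charVolterra_eq_zero hz, add_zero]
  · rw [abs_mul, abs_of_pos (he0 _)]
    have h1 : e z.1 ≤ 1 := Real.exp_le_one_iff.2 (by nlinarith)
    calc e z.1 * |v z| ≤ 1 * ‖v‖ :=
          mul_le_mul h1 (v.norm_coe_le_norm z) (abs_nonneg _) zero_le_one
      _ ≤ _ := by rw [one_mul]; exact hvn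

end charVolterra

section kernel

variable {a lam : ℝ} {d Q : ℝ → ℝ}

lemma integrable_indicator_Icc_mul_comp_sub (hd : Integrable d) :
    Integrable fun w : ℝ × ℝ => (Set.Icc 0 a).indicator (fun _ => (1 : ℝ)) w.2 * d (w.1 - w.2) := by
  have h1 : Integrable ((Set.Icc 0 a).indicator fun _ => (1 : ℝ)) :=
    (integrable_indicator_iff measurableSet_Icc).2 (integrableOn_const (by simp))
  exact h1.convolution_integrand (ContinuousLinearMap.mul ℝ ℝ) hd

lemma indicator_Icc_snd_eq_one {w : ℝ × ℝ} (hw : w ∈ charTriangle a) :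
    (Set.Icc 0 a).indicator (fun _ => (1 : ℝ)) w.2 = 1 :=
  Set.indicator_of_mem (show w.2 ∈ Set.Icc 0 a from ⟨hw.1, hw.2.1.trans hw.2.2⟩) _

lemma integrableOn_charTriangle_comp_sub (hd : Integrable d) :
    IntegrableOn (fun w : ℝ × ℝ => d (w.1 - w.2)) (charTriangle a) := by
  refine (integrable_indicator_Icc_mul_comp_sub (a := a) hd).integrableOn.congr_fun (fun w hw => ?_)
    (measurableSet_charTriangle a)
  dsimp only
  rw [indicator_Icc_snd_eq_one hw, one_mul]

lemma setIntegral_charTriangle_abs_comp_sub_le (ha : 0 ≤ a) (hd : Integrable d) :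
    ∫ w in charTriangle a, |d (w.1 - w.2)| ≤ a * ∫ s, |d s| := by
  have h := integrable_indicator_Icc_mul_comp_sub (a := a) hd.abs
  calc ∫ w in charTriangle a, |d (w.1 - w.2)|
      = ∫ w in charTriangle a,
          (Set.Icc 0 a).indicator (fun _ => (1 : ℝ)) w.2 * |d (w.1 - w.2)| := by
        refine setIntegral_congr_fun (measurableSet_charTriangle a) fun w hw => ?_
        rw [indicator_Icc_snd_eq_one hw, one_mul]
    _ ≤ ∫ w : ℝ × ℝ, (Set.Icc 0 a).indicator (fun _ => (1 : ℝ)) w.2 * |d (w.1 - w.2)| :=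
        setIntegral_le_integral h (.of_forall fun w =>
          mul_nonneg (Set.indicator_nonneg (fun _ _ => zero_le_one) _) (abs_nonneg _))
    _ = ∫ β, ∫ α, (Set.Icc 0 a).indicator (fun _ => (1 : ℝ)) β * |d (α - β)| := by
        rw [Measure.volume_eq_prod] at h ⊢
        exact integral_prod_symm _ h
    _ = a * ∫ s, |d s| := by
        simp_rw [integral_const_mul, integral_sub_right_eq_self (fun s => |d s|)]
        rw [integral_mul_const, integral_indicator_const _ measurableSet_Icc]
        simp [ha]

/-- The kernel `q(α - β) - q₀(α + β)` of the Gelfand–Levitan map. -/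
noncomputable def glKernel (lam : ℝ) (Q : ℝ → ℝ) (w : ℝ × ℝ) : ℝ :=
  (-lam * Real.exp (-2 * (w.1 - w.2)) + Q (w.1 - w.2)) - -lam * Real.exp (-2 * (w.1 + w.2))

lemma integrableOn_glKernel (hQ : Integrable Q) : IntegrableOn (glKernel lam Q) (charTriangle a) :=
  have h1 : IntegrableOn (fun w : ℝ × ℝ => -lam * Real.exp (-2 * (w.1 - w.2))) (charTriangle a) :=
    (Continuous.continuousOn (by fun_prop)).integrableOn_compact (isCompact_charTriangle a)
  have h2 : IntegrableOn (fun w : ℝ × ℝ => -lam * Real.exp (-2 * (w.1 + w.2))) (charTriangle a) :=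
    (Continuous.continuousOn (by fun_prop)).integrableOn_compact (isCompact_charTriangle a)
  (h1.add (integrableOn_charTriangle_comp_sub hQ)).sub h2

lemma abs_glKernel_le (hlam : 0 ≤ lam) {w : ℝ × ℝ} (hw : w ∈ charTriangle a) :
    |glKernel lam Q w| ≤ lam + |Q (w.1 - w.2)| := by
  obtain ⟨h0, h1, -⟩ := hw
  have e1 : Real.exp (-2 * (w.1 - w.2)) ≤ 1 := Real.exp_le_one_iff.2 (by linarith)
  have e2 : Real.exp (-2 * (w.1 + w.2)) ≤ 1 := Real.exp_le_one_iff.2 (by linarith)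
  have e1' := Real.exp_pos (-2 * (w.1 - w.2))
  have e2' := Real.exp_pos (-2 * (w.1 + w.2))
  have h : |lam * (Real.exp (-2 * (w.1 + w.2)) - Real.exp (-2 * (w.1 - w.2)))| ≤ lam * 1 := by
    rw [abs_mul, abs_of_nonneg hlam]
    exact mul_le_mul_of_nonneg_left (abs_le.2 ⟨by linarith, by linarith⟩) hlam
  calc |glKernel lam Q w|
      = |lam * (Real.exp (-2 * (w.1 + w.2)) - Real.exp (-2 * (w.1 - w.2))) + Q (w.1 - w.2)| := by
        rw [glKernel]; ring_nf
    _ ≤ _ := abs_add_le _ _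
    _ ≤ lam + |Q (w.1 - w.2)| := by linarith

lemma integral_abs_indicator_glKernel_le (hlam : 0 ≤ lam) (ha : 0 ≤ a) (hQ : Integrable Q) (α : ℝ) :
    ∫ β, |(charTriangle a).indicator (glKernel lam Q) (α, β)| ≤ lam * a + ∫ s, |Q s| := by
  have h1 : Integrable ((Set.Icc 0 a).indicator fun _ => lam) :=
    (integrable_indicator_iff measurableSet_Icc).2 (integrableOn_const (by simp))
  have h2 : Integrable fun β => |Q (α - β)| := (hQ.comp_sub_left α).abs
  calc ∫ β, |(charTriangle a).indicator (glKernel lam Q) (α, β)|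
      ≤ ∫ β, ((Set.Icc 0 a).indicator (fun _ => lam) β + |Q (α - β)|) := by
        refine integral_mono_of_nonneg (.of_forall fun β => abs_nonneg _) (h1.add h2)
          (.of_forall fun β => ?_)
        dsimp only
        by_cases hw : (α, β) ∈ charTriangle a
        · rw [Set.indicator_of_mem hw,
            Set.indicator_of_mem (show β ∈ Set.Icc 0 a from ⟨hw.1, hw.2.1.trans hw.2.2⟩)]
          exact abs_glKernel_le hlam hw
        · rw [Set.indicator_of_notMem hw, abs_zero]
          exact add_nonneg (Set.indicator_nonneg (fun _ _ => hlam) _) (abs_nonneg _)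
    _ = lam * a + ∫ s, |Q s| := by
        rw [integral_add h1 h2, integral_indicator_const _ measurableSet_Icc,
          integral_sub_left_eq_self (fun s => |Q s|)]
        simp [ha, mul_comm]

lemma mapsTo_charTriangle :
    Set.MapsTo (fun w : ℝ × ℝ => (w.1 - w.2, w.1 + w.2)) (charTriangle a)
      {w : ℝ × ℝ | 0 ≤ w.1 ∧ w.1 ≤ w.2} := fun w hw =>
  ⟨sub_nonneg.2 hw.2.1, by have := hw.1; dsimp only; linarith⟩

lemma GLop_eq_charVolterra (hQ : Integrable Q) {L : ℝ × ℝ → ℝ}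
    (hL : ContinuousOn L {w : ℝ × ℝ | 0 ≤ w.1 ∧ w.1 ≤ w.2})
    (hL0 : ∀ w : ℝ × ℝ, 2 * a ≤ w.1 + w.2 → L w = 0) {x t : ℝ} (hx : 0 ≤ x) (hxt : x ≤ t) :
    GLop (fun y => -lam * Real.exp (-2 * y) + Q y) (fun y => -lam * Real.exp (-2 * y)) L (x, t) =
      charVolterra a (glKernel lam Q) (fun w => L (w.1 - w.2, w.1 + w.2))
        ((t + x) / 2, (t - x) / 2) := by
  have hG := integrable_indicator_charTriangle_mul (m := fun w : ℝ × ℝ => L (w.1 - w.2, w.1 + w.2))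
    (integrableOn_glKernel (a := a) (lam := lam) hQ)
    (hL.comp (Continuous.continuousOn (by fun_prop)) mapsTo_charTriangle)
  rw [GLop, charVolterra, Measure.volume_eq_prod, setIntegral_prod _ hG.integrableOn]
  refine setIntegral_congr_fun measurableSet_Ioi fun α hα => ?_
  dsimp only at hα ⊢
  rw [intervalIntegral.integral_of_le (by linarith)]
  refine setIntegral_congr_fun measurableSet_Ioc fun β hβ => ?_
  have hα' : (t + x) / 2 < α := hα
  obtain ⟨hβ0, hβ1⟩ := hβ
  by_cases h : α ≤ a
  · rw [Set.indicator_of_mem (show (α, β) ∈ charTriangle a from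
      ⟨hβ0.le, by dsimp only; linarith, h⟩)]
    rfl
  · rw [Set.indicator_of_notMem (fun h' => h h'.2.2), hL0 _ (by dsimp only; linarith), mul_zero]

end kernel

lemma continuous_setIntegral_Ioi {f : ℝ → ℝ} (hf : Integrable f) :
    Continuous fun x => ∫ s in Set.Ioi x, f s := by
  have h : (fun x => ∫ s in Set.Ioi x, f s) = fun x => (∫ s, f s) - ∫ s in Set.Iic x, f s := by
    funext x
    rw [← integral_add_compl (measurableSet_Iic (a := x)) hf, Set.compl_Iic]
    ring
  have h2 : (fun x => ∫ s in Set.Iic x, f s) =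
      fun x => (∫ s in Set.Iic 0, f s) + ∫ s in (0 : ℝ)..x, f s := by
    funext x
    rw [← intervalIntegral.integral_Iic_sub_Iic hf.integrableOn hf.integrableOn]
    ring
  rw [h]
  refine continuous_const.sub ?_
  rw [h2]
  exact continuous_const.add
    (intervalIntegral.continuous_primitive (fun _ _ => hf.intervalIntegrable) 0)

/-- Continuity of the Gelfand–Levitan kernel with respect to the potential: if `K` is the
fixed-point kernel associated with `Q`, there are `η, C > 0` such that for every integrable
`Q̃` supported in `[0, a]` with `‖Q̃ − Q‖_{L¹} ≤ η`, the kernel `K_{Q̃}` exists and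
`‖K_{Q̃} − K‖_∞ ≤ C ‖Q̃ − Q‖_{L¹}` on `Ω`. -/
theorem GL_kernel_continuous_in_Q (lam a : ℝ) (hlam : 0 < lam) (ha : 0 < a)
    (Q : ℝ → ℝ) (hQ : Integrable Q) (hQsupp : Function.support Q ⊆ Set.Icc 0 a)
    (M : ℝ)
    (hM : ∀ x t : ℝ, 0 ≤ x → x ≤ t → ∀ α ∈ Set.Icc ((t - x) / 2) a,
      (∫ β in (0:ℝ)..((t - x) / 2),
        |(-lam * Real.exp (-2 * (α - β)) + Q (α - β)) - (-lam * Real.exp (-2 * (α + β)))|)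
        ≤ M)
    (K : ℝ × ℝ → ℝ)
    (hKcont : ContinuousOn K {w : ℝ × ℝ | 0 ≤ w.1 ∧ w.1 ≤ w.2})
    (hKzero : ∀ w : ℝ × ℝ, 2 * a ≤ w.1 + w.2 → K w = 0)
    (hKfix : ∀ x t : ℝ, 0 ≤ x → x ≤ t →
      K (x, t) = (1 / 2) * (∫ s in Set.Ioi ((t + x) / 2), Q s) +
        GLop (fun y => -lam * Real.exp (-2 * y) + Q y)
          (fun y => -lam * Real.exp (-2 * y)) K (x, t)) :
    ∃ η C : ℝ, 0 < η ∧ 0 < C ∧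
      ∀ Qt : ℝ → ℝ, Integrable Qt → Function.support Qt ⊆ Set.Icc 0 a →
        (∫ s, |Qt s - Q s|) ≤ η →
        ∃ Kt : ℝ × ℝ → ℝ,
          ContinuousOn Kt {w : ℝ × ℝ | 0 ≤ w.1 ∧ w.1 ≤ w.2} ∧
          (∀ w : ℝ × ℝ, 2 * a ≤ w.1 + w.2 → Kt w = 0) ∧
          (∀ x t : ℝ, 0 ≤ x → x ≤ t →
            Kt (x, t) = (1 / 2) * (∫ s in Set.Ioi ((t + x) / 2), Qt s) +
              GLop (fun y => -lam * Real.exp (-2 * y) + Qt y)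
                (fun y => -lam * Real.exp (-2 * y)) Kt (x, t)) ∧
          (∀ w : ℝ × ℝ, 0 ≤ w.1 → w.1 ≤ w.2 →
            |Kt w - K w| ≤ C * ∫ s, |Qt s - Q s|) := by
  set U : ℝ × ℝ → ℝ := fun w => K (w.1 - w.2, w.1 + w.2) with hU
  have hUc : ContinuousOn U (charTriangle a) :=
    hKcont.comp (Continuous.continuousOn (by fun_prop)) mapsTo_charTriangle
  obtain ⟨B, hB⟩ := (isCompact_charTriangle a).exists_bound_of_continuousOn hUc
  have hB0 : 0 ≤ B := (norm_nonneg _).trans (hB (0, 0) ⟨le_rfl, le_rfl, ha.le⟩)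
  have hQ0 : 0 ≤ ∫ s, |Q s| := integral_nonneg fun _ => abs_nonneg _
  set P : ℝ := lam * a + ((∫ s, |Q s|) + 1) with hPdef
  have hP0 : 0 < P := by positivity
  refine ⟨1, 2 * (Real.exp (2 * P * a) * (1 / 2 + B * a)), one_pos, by positivity,
    fun Qt hQt hQts hδ => ?_⟩
  set δ : ℝ := ∫ s, |Qt s - Q s|
  set d : ℝ → ℝ := fun s => Qt s - Q s with hd
  have hdi : Integrable d := hQt.sub hQ
  have hQtn : ∫ s, |Qt s| ≤ (∫ s, |Q s|) + 1 := by
    calc ∫ s, |Qt s| ≤ ∫ s, (|Q s| + |d s|) := by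
          refine integral_mono hQt.abs (hQ.abs.add hdi.abs) fun s => ?_
          calc |Qt s| = |Q s + d s| := by simp [hd]
            _ ≤ _ := abs_add_le _ _
      _ = (∫ s, |Q s|) + δ := integral_add hQ.abs hdi.abs
      _ ≤ _ := by linarith
  set D : ℝ × ℝ → ℝ := fun w => d (w.1 - w.2) with hD
  have hDi : IntegrableOn D (charTriangle a) := integrableOn_charTriangle_comp_sub hdi
  set F : ℝ × ℝ → ℝ := fun z => 1 / 2 * (∫ s in Set.Ioi z.1, d s) + charVolterra a D U z with hF
  have hFc : Continuous F := (continuous_const.mul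
    ((continuous_setIntegral_Ioi hdi).comp continuous_fst)).add (continuous_charVolterra hDi hUc)
  have hF0 : ∀ z, a ≤ z.1 → F z = 0 := by
    intro z hz
    have h : ∫ s in Set.Ioi z.1, d s = 0 := by
      refine setIntegral_eq_zero_of_forall_eq_zero fun s hs => ?_
      have hs' : s ∉ Set.Icc 0 a := fun h => absurd (hz.trans_lt hs) h.2.not_gt
      have h1 := Function.notMem_support.1 fun h => hs' (hQsupp h)
      have h2 := Function.notMem_support.1 fun h => hs' (hQts h)
      simp [hd, h1, h2]
    simp only [hF, h, charVolterra_eq_zero hz, mul_zero, add_zero]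
  have hFB : ∀ z, |F z| ≤ (1 / 2 + B * a) * δ := by
    intro z
    have h1 : |∫ s in Set.Ioi z.1, d s| ≤ δ :=
      (norm_integral_le_integral_norm _).trans
        (setIntegral_le_integral hdi.norm (.of_forall fun _ => norm_nonneg _))
    have h2 : |charVolterra a D U z| ≤ B * (a * δ) :=
      (abs_charVolterra_le_mul_setIntegral hDi hUc hB z).trans
        (mul_le_mul_of_nonneg_left (setIntegral_charTriangle_abs_comp_sub_le ha.le hdi) hB0)
    calc |F z| ≤ |1 / 2 * ∫ s in Set.Ioi z.1, d s| + |charVolterra a D U z| := abs_add_le _ _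
      _ ≤ 1 / 2 * δ + B * (a * δ) := by
          rw [abs_mul, abs_of_pos (by norm_num : (0 : ℝ) < 1 / 2)]
          gcongr
      _ = _ := by ring
  have hkt : IntegrableOn (glKernel lam Qt) (charTriangle a) := integrableOn_glKernel hQt
  obtain ⟨u, huc, hu0, hu, hub⟩ := exists_eq_add_charVolterra hP0 hkt
    (fun α => (integral_abs_indicator_glKernel_le hlam.le ha.le hQt α).trans
      (by rw [hPdef]; gcongr)) hFc hF0 hFB
  set Kt : ℝ × ℝ → ℝ := fun w => K w + u ((w.2 + w.1) / 2, (w.2 - w.1) / 2) with hKt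
  have hKtc : ContinuousOn Kt {w : ℝ × ℝ | 0 ≤ w.1 ∧ w.1 ≤ w.2} :=
    hKcont.add (huc.comp (by fun_prop)).continuousOn
  have hKt0 : ∀ w : ℝ × ℝ, 2 * a ≤ w.1 + w.2 → Kt w = 0 := fun w hw => by
    simp only [hKt]
    rw [hKzero w hw, hu0 _ (by dsimp only; linarith), add_zero]
  refine ⟨Kt, hKtc, hKt0, fun x t hx hxt => ?_, fun w hw hw' => ?_⟩
  · have hKtU : (fun w : ℝ × ℝ => Kt (w.1 - w.2, w.1 + w.2)) = fun w => U w + u w := by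
      funext w
      have h1 : (w.1 + w.2 + (w.1 - w.2)) / 2 = w.1 := by ring
      have h2 : (w.1 + w.2 - (w.1 - w.2)) / 2 = w.2 := by ring
      simp only [hKt, hU, h1, h2]
    have hkQ : glKernel lam Qt = fun w => glKernel lam Q w + D w := by
      funext w
      simp only [glKernel, hD, hd]
      ring
    have hint : ∫ s in Set.Ioi ((t + x) / 2), d s =
        (∫ s in Set.Ioi ((t + x) / 2), Qt s) - ∫ s in Set.Ioi ((t + x) / 2), Q s :=
      integral_sub hQt.integrableOn hQ.integrableOn
    rw [GLop_eq_charVolterra hQt hKtc hKt0 hx hxt, hKtU,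
      charVolterra_add_right hkt hUc huc.continuousOn]
    conv_rhs => rw [show charVolterra a (glKernel lam Qt) U =
      charVolterra a (fun w => glKernel lam Q w + D w) U by rw [hkQ]]
    rw [charVolterra_add_left (integrableOn_glKernel hQ) hDi hUc]
    have hK := hKfix x t hx hxt
    rw [GLop_eq_charVolterra hQ hKcont hKzero hx hxt] at hK
    have huz := hu ((t + x) / 2, (t - x) / 2)
    simp only [hF, hint] at huz
    simp only [hKt]
    rw [hK]
    linarith
  · have h := hub ((w.2 + w.1) / 2, (w.2 - w.1) / 2) (by dsimp only; linarith)
    calc |Kt w - K w| = |u ((w.2 + w.1) / 2, (w.2 - w.1) / 2)| := by simp [hKt]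
      _ ≤ _ := h
      _ = _ := by ring
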